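/- Let $q$ be a prime power and $n \in \mathbb{N}$ with $d(n) < q + 2$, where $d(n)$ is the number of positive divisors of $n$. Then $\psi(\mathbb{F}_{q^n}, \mathbb{F}_q) + \phi(\mathbb{F}_{q^n}, \mathbb{F}_q) = n$. -/

import Mathlib

open Module in
theorem aux_cover {K F ι : Type*} [Field K] [Fintype K] [AddCommGroup F] [Module K F]
    [FiniteDimensional K F] (s : Finset ι) (p : ι → Submodule K F)
    (hs : s.card ≤ Fintype.card K) (hp : ∀ i ∈ s, finrank K (p i) < finrank K F) :
    ∃ x, ∀ i ∈ s, x ∉ p i := by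
  classical
  rcases s.eq_empty_or_nonempty with rfl | ⟨i0, hi0⟩
  · exact ⟨0, by simp⟩
  by_contra! h
  have : Finite F := Module.finite_of_finite K
  have : Fintype F := Fintype.ofFinite F
  have hn := hp i0 hi0
  obtain ⟨m, hm⟩ : ∃ m, finrank K F = m + 1 := ⟨finrank K F - 1, by omega⟩
  have hq : 1 < Fintype.card K := Fintype.one_lt_card
  have hsub : (Finset.univ.erase (0 : F)) ⊆
      s.biUnion (fun i => (Finset.univ.filter (fun x => x ∈ p i)).erase 0) := by
    intro x hx
    obtain ⟨i, hi, hxi⟩ := h x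
    simp only [Finset.mem_biUnion, Finset.mem_erase, Finset.mem_filter, Finset.mem_univ, true_and]
    exact ⟨i, hi, by simpa using hx, hxi⟩
  have h1 := Finset.card_le_card hsub
  have h2 := Finset.card_biUnion_le_card_mul s
    (fun i => (Finset.univ.filter (fun x => x ∈ p i)).erase 0) (Fintype.card K ^ m - 1) (by
      intro i hi
      rw [Finset.card_erase_of_mem (by simp)]
      apply Nat.sub_le_sub_right
      have h3 : (Finset.univ.filter (fun x => x ∈ p i)).card = Fintype.card K ^ finrank K (p i) := by
        rw [← Module.card_eq_pow_finrank (K := K) (V := p i)]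
        exact (Fintype.card_subtype _).symm
      rw [h3]
      have := hp i hi
      exact Nat.pow_le_pow_right (by omega) (by omega))
  rw [Finset.card_erase_of_mem (by simp), Finset.card_univ,
    Module.card_eq_pow_finrank (K := K) (V := F), hm] at h1
  have h4 := Nat.mul_le_mul_right (Fintype.card K ^ m - 1) hs
  have h5 : 0 < Fintype.card K ^ m := by positivity
  have h6 := h1.trans (h2.trans h4)
  rw [pow_succ, Nat.mul_sub, mul_comm] at h6
  have : Fintype.card K * 1 ≤ Fintype.card K * Fintype.card K ^ m := Nat.mul_le_mul_left _ h5
  omega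

open Module in
theorem aux_compl {K F ι : Type*} [Field K] [Fintype K] [AddCommGroup F] [Module K F]
    [FiniteDimensional K F] (s : Finset ι) (p : ι → Submodule K F) (m : ℕ)
    (hne : s.Nonempty) (hs : s.card ≤ Fintype.card K) (hp : ∀ i ∈ s, finrank K (p i) ≤ m)
    (k : ℕ) (hk : k + m ≤ finrank K F) :
    ∃ V : Submodule K F, finrank K V = k ∧ ∀ i ∈ s, Disjoint V (p i) := by
  induction k with
  | zero => exact ⟨⊥, by simp, by simp⟩
  | succ k ih =>
    obtain ⟨V, hV, hd⟩ := ih (by omega)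
    obtain ⟨x, hx⟩ := aux_cover s (fun i => V ⊔ p i) hs (by
      intro i hi
      have := Submodule.finrank_add_le_finrank_add_finrank V (p i)
      have := hp i hi
      omega)
    obtain ⟨i0, hi0⟩ := hne
    have hxV : x ∉ V := fun h => hx i0 hi0 (Submodule.mem_sup_left h)
    have hx0 : x ≠ 0 := fun h => hxV (h ▸ V.zero_mem)
    refine ⟨V ⊔ Submodule.span K {x}, ?_, ?_⟩
    · have h1 := Submodule.finrank_sup_add_finrank_inf_eq V (Submodule.span K {x})
      have h2 : V ⊓ Submodule.span K {x} = ⊥ :=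
        disjoint_iff.1 ((Submodule.disjoint_span_singleton' hx0).2 hxV)
      rw [h2, finrank_bot, finrank_span_singleton hx0] at h1
      omega
    · intro i hi
      rw [Submodule.disjoint_def]
      intro y hy hyp
      obtain ⟨v, hv, w, hw, rfl⟩ := Submodule.mem_sup.1 hy
      obtain ⟨c, rfl⟩ := Submodule.mem_span_singleton.1 hw
      have hc : c = 0 := by
        by_contra hc
        apply hx i hi
        have : x = c⁻¹ • (-v + (v + c • x)) := by simp [smul_smul, hc]
        rw [this]
        exact Submodule.smul_mem _ _ (Submodule.add_mem_sup (V.neg_mem hv) hyp)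
      subst hc
      simp only [zero_smul, add_zero] at hyp ⊢
      exact (Submodule.disjoint_def.1 (hd i hi)) v hv hyp

open Module Polynomial in
theorem aux_inj {K F : Type*} [Field K] [Fintype K] [Field F] [Algebra K F]
    [FiniteDimensional K F] (M N : IntermediateField K F) (h : finrank K M = finrank K N) :
    M = N := by
  classical
  have : Finite F := Module.finite_of_finite K
  have : Fintype F := Fintype.ofFinite F
  set Q := Fintype.card K ^ finrank K M with hQ
  have hQ1 : 1 < Q := Nat.one_lt_pow (Module.finrank_pos).ne' Fintype.one_lt_card
  have hf0 : (X ^ Q - X : F[X]) ≠ 0 := FiniteField.X_pow_card_sub_X_ne_zero F hQ1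
  have key : ∀ L : IntermediateField K F, finrank K L = finrank K M →
      Finset.univ.filter (fun x => x ∈ L) = (X ^ Q - X : F[X]).roots.toFinset := by
    intro L hL
    have hc : Fintype.card L = Q := by
      rw [Module.card_eq_pow_finrank (K := K) (V := L), hL]
    apply Finset.eq_of_subset_of_card_le
    · intro x hx
      have hx : x ∈ L := by simpa using hx
      rw [Multiset.mem_toFinset, mem_roots hf0]
      have := FiniteField.pow_card (⟨x, hx⟩ : L)
      rw [hc] at this
      have h2 := congrArg Subtype.val this
      simp only [SubmonoidClass.mk_pow] at h2
      simp [h2]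
    · refine (Multiset.toFinset_card_le _).trans ((card_roots' _).trans ?_)
      rw [FiniteField.X_pow_card_sub_X_natDegree_eq F hQ1, ← hc]
      exact (Fintype.card_subtype _).le
  have h3 := (key M rfl).trans (key N h.symm).symm
  ext x
  simpa using Finset.ext_iff.1 h3 x


/-- Let `K` be a finite field with `q` elements and `K ⊂ F` the finite field
extension of degree `n`. If `d(n) < q + 2`, then `ψ(F,K) + φ(F,K) = n`, where
`ψ(F,K)` is the largest degree of a proper intermediate subfield and `φ(F,K)`
is the largest dimension of a primitive `K`-subspace of `F`. -/
theorem stmt5 (K F : Type*) [Field K] [Fintype K] [Field F] [Algebra K F]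
    [FiniteDimensional K F] (n : ℕ) (hn : Module.finrank K F = n)
    (hd : n.divisors.card < Fintype.card K + 2)
    (ψ φ : ℕ)
    (hψ : IsGreatest
      {d : ℕ | ∃ M : IntermediateField K F, M ≠ ⊤ ∧ Module.finrank K M = d} ψ)
    (hφ : IsGreatest
      {d : ℕ | ∃ V : Submodule K F,
        (∀ a ∈ V, a ≠ 0 → IntermediateField.adjoin K {a} = ⊤) ∧
        Module.finrank K V = d} φ) :
    ψ + φ = n := by
  classical
  have : Finite F := Module.finite_of_finite K
  have hnpos : 0 < n := hn ▸ Module.finrank_pos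
  have hfin : Finite (IntermediateField K F) :=
    Finite.of_injective (fun M => (M : Set F)) SetLike.coe_injective
  have : Fintype (IntermediateField K F) := Fintype.ofFinite _
  obtain ⟨⟨M, hM, hMψ⟩, hψmax⟩ := hψ
  obtain ⟨⟨V, hV, hVφ⟩, hφmax⟩ := hφ
  apply le_antisymm
  · have hdis : Disjoint (Subalgebra.toSubmodule M.toSubalgebra) V := by
      rw [Submodule.disjoint_def]
      intro x hxM hxV
      by_contra hx0
      apply hM
      rw [eq_top_iff, ← hV x hxV hx0, IntermediateField.adjoin_simple_le_iff]
      exact hxM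
    have := Submodule.finrank_add_finrank_le_of_disjoint hdis
    rw [hn, hVφ] at this
    rw [← hMψ]
    exact this
  · set s : Finset (IntermediateField K F) := Finset.univ.filter (fun L => L ≠ ⊤) with hs
    have hcard : s.card ≤ Fintype.card K := by
      have h1 : s.card ≤ n.properDivisors.card := by
        apply Finset.card_le_card_of_injOn (fun L : IntermediateField K F => Module.finrank K L)
        · intro L hL
          have hL : L ≠ ⊤ := by simpa [hs] using hL
          have hdvd : Module.finrank K L ∣ n := 
            hn ▸ Dvd.intro _ (Module.finrank_mul_finrank K L F)
          simp only [Finset.mem_coe, Nat.mem_properDivisors]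
          refine ⟨hdvd, lt_of_le_of_ne (Nat.le_of_dvd hnpos hdvd) fun h => hL ?_⟩
          apply aux_inj
          rw [h, IntermediateField.finrank_top', hn]
        · intro L _ L' _ h
          exact aux_inj L L' h
      have h2 : n.divisors.card = n.properDivisors.card + 1 := by
        rw [← Nat.insert_self_properDivisors hnpos.ne', Finset.card_insert_of_notMem (by simp)]
      omega
    have hψn : ψ ≤ n := by
      rw [← hMψ, ← hn]
      exact Submodule.finrank_le (Subalgebra.toSubmodule M.toSubalgebra)
    obtain ⟨W, hW, hWd⟩ := aux_compl s (fun L => Subalgebra.toSubmodule L.toSubalgebra) ψ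
      ⟨M, by simpa [hs] using hM⟩ hcard
      (by
        intro L hL
        exact hψmax ⟨L, by simpa [hs] using hL, rfl⟩) (n - ψ) (by omega)
    have := hφmax ⟨W, fun a ha ha0 => by
      by_contra hne
      exact ha0 (Submodule.disjoint_def.1 (hWd (IntermediateField.adjoin K {a})
        (by simpa [hs] using hne)) a ha (IntermediateField.mem_adjoin_simple_self K a)), hW⟩
    omega
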